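/- arXiv:1804.02046 — 2 statements merged into one kernel-verified Lean document; each statement's English description precedes it below -/
import Mathlib

section
/- (Second order linear difference equation.) Let n ≥ 2 be an integer and i ∈ {1,2}. Define ℱ_n(x) = Θ̃_n(x)Θ̃_n(x ± 1)/Λ_{1,n}^{(1)}(x ± 1); 𝒢_n(x) = Θ̃_n(x)𝒟_iΘ̃_n(x)/Λ_{1,n}^{(1)}(x ± 1) − Θ̃_n(x)² 𝒟_iΛ_{1,n}^{(1)}(x)/(Λ_{1,n}^{(1)}(x)Λ_{1,n}^{(1)}(x ± 1)) + Θ̃_n(x)Λ_{2,n}^{(1)}(x ± 1)/Λ_{1,n}^{(1)}(x ± 1) + Θ̃_n(x)Λ_{1,n}^{(2)}(x)/Λ_{1,n}^{(1)}(x); and ℋ_n(x) = Θ̃_n(x)𝒟_iΛ_{2,n}^{(1)}(x)/Λ_{1,n}^{(1)}(x ± 1) − Θ̃_n(x)Λ_{2,n}^{(1)}(x)𝒟_iΛ_{1,n}^{(1)}(x)/(Λ_{1,n}^{(1)}(x)Λ_{1,n}^{(1)}(x ± 1)) + Λ_{1,n}^{(2)}(x)Λ_{2,n}^{(1)}(x)/Λ_{1,n}^{(1)}(x)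 − Λ_{2,n}^{(2)}(x). Then for every real x at which all these rational functions are defined (in particular Λ_{1,n}^{(1)}(x) ≠ 0 and Λ_{1,n}^{(1)}(x ± 1) ≠ 0), ℱ_n(x) 𝒟_i² Q_n^{(i)}(x) + 𝒢_n(x) 𝒟_i Q_n^{(i)}(x) + ℋ_n(x) Q_n^{(i)}(x) = 0. -/
open Finset Filter Topology Polynomial

noncomputable section

/-- Pochhammer symbol `(a)_k = a(a+1)⋯(a+k−1)`. -/
def poch (a : ℝ) (k : ℕ) : ℝ := ∏ m ∈ Finset.range k, (a + m)

/-- Falling factorial `[x]_k = x(x−1)⋯(x−k+1)`. -/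
def fall (x : ℝ) (k : ℕ) : ℝ := ∏ m ∈ Finset.range k, (x - m)

/-- `⟨x⟩_i^k`: falling factorial for `i = 1`, Pochhammer symbol for `i = 2`. -/
def br (i : ℕ) (x : ℝ) (k : ℕ) : ℝ := if i = 1 then fall x k else poch x k

/-- Forward (`i = 1`) resp. backward (`i = 2`) difference operator `𝒟_i`. -/
def Dop (i : ℕ) (f : ℝ → ℝ) : ℝ → ℝ :=
  fun x => if i = 1 then f (x + 1) - f x else f x - f (x - 1)

/-- Iterated difference operator `𝒟_i^k`. -/
def Dk (i k : ℕ) (f : ℝ → ℝ) : ℝ → ℝ := (Dop i)^[k] f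

/-- Kronecker delta `δ_{i,m}` (real valued). -/
def kdelta (i m : ℕ) : ℝ := if i = m then 1 else 0

/-- The shift `x ± 1`: `x + 1` for `i = 1`, `x - 1` for `i = 2`. -/
def sh (i : ℕ) (x : ℝ) : ℝ := if i = 1 then x + 1 else x - 1

/-- Monic Meixner polynomial `M_n(x)`. -/
def MeixnerM (γ μ : ℝ) (n : ℕ) (x : ℝ) : ℝ :=
  poch γ n * (μ / (μ - 1)) ^ n *
    ∑ k ∈ Finset.range (n + 1),
      poch (-(n : ℝ)) k * poch (-x) k / poch γ k * (1 - μ⁻¹) ^ k / (Nat.factorial k : ℝ)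

/-- Meixner inner product `⟨p,q⟩ = ∑_{x≥0} p(x)q(x) μ^x (γ)_x / x!`. -/
def mIP (γ μ : ℝ) (p q : ℝ → ℝ) : ℝ :=
  ∑' x : ℕ, p x * q x * μ ^ x * poch γ x / (Nat.factorial x : ℝ)

/-- Squared Meixner norm `‖M_n‖²`. -/
def nrm2 (γ μ : ℝ) (n : ℕ) : ℝ := mIP γ μ (MeixnerM γ μ n) (MeixnerM γ μ n)

/-- Kernel `K_n^{(l,m)}(x,y)` for the operator `𝒟_i`. -/
def Klm (γ μ : ℝ) (i l m n : ℕ) (x y : ℝ) : ℝ :=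
  ∑ k ∈ Finset.range (n + 1),
    Dk i l (MeixnerM γ μ k) x * Dk i m (MeixnerM γ μ k) y / nrm2 γ μ k

/-- Sobolev inner product `⟨p,q⟩_λ = ⟨p,q⟩ + λ 𝒟_i^j p(α) 𝒟_i^j q(α)`. -/
def sIP (γ μ lam α : ℝ) (i j : ℕ) (p q : ℝ → ℝ) : ℝ :=
  mIP γ μ p q + lam * Dk i j p α * Dk i j q α

/-- `Q` is the monic Sobolev orthogonal polynomial of degree `n`. -/
def IsSobolevOP (γ μ lam α : ℝ) (i j n : ℕ) (Q : Polynomial ℝ) : Prop :=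
  Q.Monic ∧ Q.natDegree = n ∧
    ∀ p : Polynomial ℝ, p.degree < (n : WithBot ℕ) →
      sIP γ μ lam α i j (fun x => Q.eval x) (fun x => p.eval x) = 0

/-- Coefficient `a_n^{(k)}`. -/
def acoef (γ μ lam α : ℝ) (i j n k : ℕ) : ℝ :=
  -(lam * (Nat.factorial j : ℝ) * Dk i j (MeixnerM γ μ n) α * Dk i k (MeixnerM γ μ (n - 1)) α) /
    ((Nat.factorial k : ℝ) * nrm2 γ μ (n - 1) * (1 + lam * Klm γ μ i j j (n - 1) α α))

/-- Coefficient `b_n^{(k)}`. -/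
def bcoef (γ μ lam α : ℝ) (i j n k : ℕ) : ℝ :=
  lam * (Nat.factorial j : ℝ) * Dk i j (MeixnerM γ μ n) α * Dk i k (MeixnerM γ μ n) α /
    ((Nat.factorial k : ℝ) * nrm2 γ μ (n - 1) * (1 + lam * Klm γ μ i j j (n - 1) α α))

/-- Rational function `A_{1,n}(x)`. -/
def A1 (γ μ lam α : ℝ) (i j n : ℕ) (x : ℝ) : ℝ :=
  1 + (1 / br i (x - α) (j + 1)) *
    ∑ k ∈ Finset.range (j + 1), acoef γ μ lam α i j n k * br i (x - α) k

/-- Rational function `B_{1,n}(x)`. -/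
def B1 (γ μ lam α : ℝ) (i j n : ℕ) (x : ℝ) : ℝ :=
  (1 / br i (x - α) (j + 1)) *
    ∑ k ∈ Finset.range (j + 1), bcoef γ μ lam α i j n k * br i (x - α) k

/-- Meixner recurrence coefficient `α_n`. -/
def alphaR (γ μ : ℝ) (n : ℕ) : ℝ := ((n : ℝ) * (1 + μ) + μ * γ) / (1 - μ)

/-- Meixner recurrence coefficient `β_n`. -/
def betaR (γ μ : ℝ) (n : ℕ) : ℝ := (n : ℝ) * μ * ((n : ℝ) + γ - 1) / (1 - μ) ^ 2

/-- Rational function `A_{2,n}(x)`. -/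
def A2 (γ μ lam α : ℝ) (i j n : ℕ) (x : ℝ) : ℝ :=
  -(B1 γ μ lam α i j (n - 1) x) / betaR γ μ (n - 1)

/-- Rational function `B_{2,n}(x)`. -/
def B2 (γ μ lam α : ℝ) (i j n : ℕ) (x : ℝ) : ℝ :=
  A1 γ μ lam α i j (n - 1) x + A2 γ μ lam α i j n x * (alphaR γ μ (n - 1) - x)

/-- Rational function `C_{1,n}(x)`. -/
def C1 (γ μ lam α : ℝ) (i j n : ℕ) (x : ℝ) : ℝ :=
  (x + γ * kdelta i 1) * Dop i (A1 γ μ lam α i j n) x + (n : ℝ) * A1 γ μ lam α i j n (sh i x)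
    - ((n : ℝ) - 1) * ((n : ℝ) + γ - 2) * μ ^ kdelta i 2 * B1 γ μ lam α i j n (sh i x) /
        (betaR γ μ (n - 1) * (1 - μ))

/-- Rational function `D_{1,n}(x)`. -/
def D1 (γ μ lam α : ℝ) (i j n : ℕ) (x : ℝ) : ℝ :=
  (x + γ * kdelta i 1) * Dop i (B1 γ μ lam α i j n) x
    + ((n : ℝ) - 1) * B1 γ μ lam α i j n (sh i x)
    + ((n : ℝ) - 1) * ((n : ℝ) + γ - 2) * (x - alphaR γ μ (n - 1)) * μ ^ kdelta i 2 *
        B1 γ μ lam α i j n (sh i x) / (betaR γ μ (n - 1) * (1 - μ))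
    + (n : ℝ) * ((n : ℝ) + γ - 1) * μ ^ kdelta i 2 * A1 γ μ lam α i j n (sh i x) / (1 - μ)

/-- Rational function `C_{2,n}(x)`. -/
def C2 (γ μ lam α : ℝ) (i j n : ℕ) (x : ℝ) : ℝ :=
  -(D1 γ μ lam α i j (n - 1) x) / betaR γ μ (n - 1)

/-- Rational function `D_{2,n}(x)`. -/
def D2 (γ μ lam α : ℝ) (i j n : ℕ) (x : ℝ) : ℝ :=
  C1 γ μ lam α i j (n - 1) x + C2 γ μ lam α i j n x * (alphaR γ μ (n - 1) - x)

/-- `A_{m,n}(x)` for `m = 1, 2`. -/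
def Aa (γ μ lam α : ℝ) (i j n m : ℕ) (x : ℝ) : ℝ :=
  if m = 1 then A1 γ μ lam α i j n x else A2 γ μ lam α i j n x

/-- `B_{m,n}(x)` for `m = 1, 2`. -/
def Bb (γ μ lam α : ℝ) (i j n m : ℕ) (x : ℝ) : ℝ :=
  if m = 1 then B1 γ μ lam α i j n x else B2 γ μ lam α i j n x

/-- `C_{k,n}(x)` for `k = 1, 2`. -/
def Cc (γ μ lam α : ℝ) (i j n k : ℕ) (x : ℝ) : ℝ :=
  if k = 1 then C1 γ μ lam α i j n x else C2 γ μ lam α i j n x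

/-- `D_{k,n}(x)` for `k = 1, 2`. -/
def Dd (γ μ lam α : ℝ) (i j n k : ℕ) (x : ℝ) : ℝ :=
  if k = 1 then D1 γ μ lam α i j n x else D2 γ μ lam α i j n x

/-- `Λ_{m,n}^{(k)}(x) = (−1)^k (C_{k,n}(x) B_{m,n}(x) − A_{m,n}(x) D_{k,n}(x))`. -/
def Lam (γ μ lam α : ℝ) (i j n m k : ℕ) (x : ℝ) : ℝ :=
  (-1 : ℝ) ^ k * (Cc γ μ lam α i j n k x * Bb γ μ lam α i j n m x
    - Aa γ μ lam α i j n m x * Dd γ μ lam α i j n k x)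

/-- `Θ_n(x) = A_{1,n}(x) B_{2,n}(x) − B_{1,n}(x) A_{2,n}(x)`. -/
def Theta (γ μ lam α : ℝ) (i j n : ℕ) (x : ℝ) : ℝ :=
  A1 γ μ lam α i j n x * B2 γ μ lam α i j n x - B1 γ μ lam α i j n x * A2 γ μ lam α i j n x

/-- `Θ̃_n(x) = (x + γ δ_{i,1}) Θ_n(x)`. -/
def Thetatil (γ μ lam α : ℝ) (i j n : ℕ) (x : ℝ) : ℝ :=
  (x + γ * kdelta i 1) * Theta γ μ lam α i j n x

lemma poch_succ (a : ℝ) (k : ℕ) : poch a (k + 1) = poch a k * (a + k) :=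
  Finset.prod_range_succ _ _

lemma poch_succ' (a : ℝ) (k : ℕ) : poch a (k + 1) = a * poch (a + 1) k := by
  unfold poch
  rw [Finset.prod_range_succ', mul_comm]
  congr 1
  · simp
  · exact Finset.prod_congr rfl fun m _ => by push_cast; ring

lemma poch_pos {γ : ℝ} (hγ : 0 < γ) (k : ℕ) : 0 < poch γ k :=
  Finset.prod_pos fun m _ => by positivity

lemma poch_neg_nat_eq_zero {n k : ℕ} (h : n < k) : poch (-(n : ℝ)) k = 0 :=
  Finset.prod_eq_zero (Finset.mem_range.2 h) (by simp)

lemma mul_poch_neg_eq (x : ℝ) (k : ℕ) :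
    x * poch (-x) k = k * poch (-x) k - poch (-x) (k + 1) := by
  rw [poch_succ]; ring

lemma poch_neg_add_one (x : ℝ) (k : ℕ) :
    poch (-(x + 1)) (k + 1) = poch (-x) (k + 1) - (k + 1) * poch (-x) k := by
  rw [poch_succ', poch_succ, show -(x + 1) + 1 = -x by ring]; ring

lemma mul_poch_neg_sub_one (x : ℝ) (k : ℕ) :
    x * (poch (-x) k - poch (-(x - 1)) k) = k * poch (-x) k := by
  have h1 := poch_succ (-x) k
  rw [poch_succ', show -x + 1 = -(x - 1) by ring] at h1
  linear_combination h1

/-- Coefficient of `(-x)_k` in the monic Meixner polynomial of degree `n`. -/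
def meixnerCoeff (γ μ : ℝ) (n k : ℕ) : ℝ :=
  poch γ n * (μ / (μ - 1)) ^ n *
    (poch (-(n : ℝ)) k / poch γ k * (1 - μ⁻¹) ^ k / (Nat.factorial k : ℝ))

lemma meixnerCoeff_eq_zero (γ μ : ℝ) {n k : ℕ} (h : n < k) : meixnerCoeff γ μ n k = 0 := by
  simp [meixnerCoeff, poch_neg_nat_eq_zero h]

lemma MeixnerM_eq_sum (γ μ : ℝ) {n N : ℕ} (h : n < N) (x : ℝ) :
    MeixnerM γ μ n x = ∑ k ∈ Finset.range N, meixnerCoeff γ μ n k * poch (-x) k := by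
  rw [← Finset.sum_subset (Finset.range_subset_range.2 (Nat.succ_le_of_lt h))
    (fun k _ hk => by
      rw [meixnerCoeff_eq_zero γ μ (by simpa using hk), zero_mul])]
  rw [MeixnerM, Finset.mul_sum]
  exact Finset.sum_congr rfl fun k _ => by rw [meixnerCoeff]; ring

lemma meixnerCoeff_pred (γ μ : ℝ) (n k : ℕ) :
    ((k : ℝ) - n) * meixnerCoeff γ μ n k
      = -(n * (n + γ - 1) * (μ / (μ - 1))) * meixnerCoeff γ μ (n - 1) k := by
  rcases n with _ | n
  · rcases k with _ | k
    · simp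
    · simp [meixnerCoeff_eq_zero γ μ (Nat.succ_pos k)]
  · have h := (poch_succ (-((n : ℝ) + 1)) k).symm.trans (poch_succ' _ _)
    rw [show -((n : ℝ) + 1) + 1 = -n by ring] at h
    simp only [meixnerCoeff, Nat.add_sub_cancel, poch_succ γ n, pow_succ]
    push_cast
    linear_combination (poch γ n * (γ + n) * (μ / (μ - 1)) ^ n * (μ / (μ - 1)) / poch γ k
      * (1 - μ⁻¹) ^ k / (Nat.factorial k : ℝ)) * h

lemma meixnerCoeff_succ_right {γ μ : ℝ} (hγ : 0 < γ) (n k : ℕ) :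
    ((k : ℝ) + 1) * (k + γ) * meixnerCoeff γ μ n (k + 1)
      = ((k : ℝ) - n) * (1 - μ⁻¹) * meixnerCoeff γ μ n k := by
  have h1 := (poch_pos hγ k).ne'
  have h2 : γ + k ≠ 0 := by positivity
  have h3 : (k : ℝ) + 1 ≠ 0 := by positivity
  have h4 : (Nat.factorial k : ℝ) ≠ 0 := by positivity
  simp only [meixnerCoeff, poch_succ, Nat.factorial_succ, pow_succ]
  push_cast
  generalize (1 - μ⁻¹) = z
  generalize (μ / (μ - 1)) ^ n = c
  field_simp
  ring

lemma meixnerCoeff_succ_zero (γ μ : ℝ) (n : ℕ) :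
    meixnerCoeff γ μ (n + 1) 0 = μ / (μ - 1) * (n + γ) * meixnerCoeff γ μ n 0 := by
  have h0 : ∀ a : ℝ, poch a 0 = 1 := fun a => Finset.prod_range_zero _
  simp only [meixnerCoeff, poch_succ γ n, pow_succ, h0]
  ring

lemma meixnerCoeff_succ_succ {γ μ : ℝ} (hγ : 0 < γ) (hμ0 : 0 < μ) (hμ1 : μ < 1) (n k : ℕ) :
    meixnerCoeff γ μ (n + 1) (k + 1)
      = μ / (μ - 1) * (k + 1 + n + γ) * meixnerCoeff γ μ n (k + 1) - meixnerCoeff γ μ n k := by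
  have h1 := (poch_pos hγ k).ne'
  have h2 : γ + k ≠ 0 := by positivity
  have h3 : (k : ℝ) + 1 ≠ 0 := by positivity
  have h4 : (Nat.factorial k : ℝ) ≠ 0 := by positivity
  have h5 : μ - 1 ≠ 0 := by linarith
  have h6 : 1 - μ⁻¹ = (μ / (μ - 1))⁻¹ := by field_simp
  have h7 : μ / (μ - 1) ≠ 0 := div_ne_zero hμ0.ne' h5
  have h8 := poch_succ' (-((n : ℝ) + 1)) k
  rw [show -((n : ℝ) + 1) + 1 = -n by ring] at h8
  simp only [meixnerCoeff, h6]
  push_cast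
  rw [h8]
  simp only [poch_succ, Nat.factorial_succ, pow_succ]
  push_cast
  generalize (μ / (μ - 1)) = c at *
  field_simp
  ring

/-- Three-term recurrence relation for the monic Meixner polynomials. -/
lemma meixner_recurrence {γ μ : ℝ} (hγ : 0 < γ) (hμ0 : 0 < μ) (hμ1 : μ < 1) (n : ℕ) (x : ℝ) :
    x * MeixnerM γ μ n x = MeixnerM γ μ (n + 1) x + alphaR γ μ n * MeixnerM γ μ n x
      + betaR γ μ n * MeixnerM γ μ (n - 1) x := by
  have h5 : μ - 1 ≠ 0 := by linarith
  have h5' : 1 - μ ≠ 0 := by linarith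
  have hβ : ∀ k : ℕ, betaR γ μ n * meixnerCoeff γ μ (n - 1) k
      = ((k : ℝ) - n) / (1 - μ) * meixnerCoeff γ μ n k := by
    intro k
    have h := meixnerCoeff_pred γ μ n k
    have : μ / (μ - 1) = - (μ / (1 - μ)) := by
      rw [← neg_sub 1 μ, div_neg]
    rw [this] at h
    rw [betaR, div_mul_eq_mul_div, div_mul_eq_mul_div, div_eq_div_iff (by positivity) h5']
    field_simp at h
    linear_combination -(1 - μ) * h
  have key : ∀ N : ℕ, ∑ k ∈ Finset.range (N + 1),
      (x * (meixnerCoeff γ μ n k * poch (-x) k) - (meixnerCoeff γ μ (n + 1) k * poch (-x) k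
        + alphaR γ μ n * (meixnerCoeff γ μ n k * poch (-x) k)
        + betaR γ μ n * (meixnerCoeff γ μ (n - 1) k * poch (-x) k)))
      = - (meixnerCoeff γ μ n N * poch (-x) (N + 1)) := by
    intro N
    induction N with
    | zero =>
      simp only [zero_add, Finset.sum_range_one]
      rw [← mul_assoc (betaR γ μ n), hβ, meixnerCoeff_succ_zero, poch_succ, alphaR]
      push_cast
      field_simp
      ring
    | succ N ih =>
      rw [Finset.sum_range_succ, ih, ← mul_assoc (betaR γ μ n), hβ,
        meixnerCoeff_succ_succ hγ hμ0 hμ1, poch_succ _ (N + 1), alphaR]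
      push_cast
      field_simp
      ring
  have h := key (n + 1)
  rw [meixnerCoeff_eq_zero γ μ (Nat.lt_succ_self n), zero_mul, neg_zero] at h
  rw [MeixnerM_eq_sum γ μ (show n < n + 1 + 1 by omega),
    MeixnerM_eq_sum γ μ (show n + 1 < n + 1 + 1 by omega),
    MeixnerM_eq_sum γ μ (show n - 1 < n + 1 + 1 by omega), Finset.mul_sum, Finset.mul_sum,
    Finset.mul_sum, ← Finset.sum_add_distrib, ← Finset.sum_add_distrib, ← sub_eq_zero,
    ← Finset.sum_sub_distrib, h]

/-- Structure relation for the backward difference of Meixner polynomials. -/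
lemma meixner_backward_structure (γ μ : ℝ) (n : ℕ)
    (x : ℝ) : x * (MeixnerM γ μ n x - MeixnerM γ μ n (x - 1)) = n * MeixnerM γ μ n x
      + n * (n + γ - 1) * μ / (1 - μ) * MeixnerM γ μ (n - 1) x := by
  rw [MeixnerM_eq_sum γ μ (show n < n + 1 by omega), MeixnerM_eq_sum γ μ (show n < n + 1 by omega),
    MeixnerM_eq_sum γ μ (show n - 1 < n + 1 by omega), ← Finset.sum_sub_distrib, Finset.mul_sum,
    Finset.mul_sum, Finset.mul_sum, ← Finset.sum_add_distrib]
  refine Finset.sum_congr rfl fun k _ => ?_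
  have h := meixnerCoeff_pred γ μ n k
  have h' := mul_poch_neg_sub_one x k
  have : μ / (μ - 1) = - (μ / (1 - μ)) := by rw [← neg_sub 1 μ, div_neg]
  rw [this] at h
  linear_combination meixnerCoeff γ μ n k * h' + poch (-x) k * h

/-- Structure relation for the forward difference of Meixner polynomials. -/
lemma meixner_forward_structure {γ μ : ℝ} (hγ : 0 < γ) (hμ0 : 0 < μ) (hμ1 : μ < 1) (n : ℕ)
    (x : ℝ) : (x + γ) * (MeixnerM γ μ n (x + 1) - MeixnerM γ μ n x) = n * MeixnerM γ μ n x
      + n * (n + γ - 1) / (1 - μ) * MeixnerM γ μ (n - 1) x := by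
  have h5' : 1 - μ ≠ 0 := by linarith
  have hβ : ∀ k : ℕ, n * (n + γ - 1) / (1 - μ) * meixnerCoeff γ μ (n - 1) k
      = ((k : ℝ) - n) * μ⁻¹ * meixnerCoeff γ μ n k := by
    intro k
    have h := meixnerCoeff_pred γ μ n k
    have : μ / (μ - 1) = - (μ / (1 - μ)) := by
      rw [← neg_sub 1 μ, div_neg]
    rw [this] at h
    field_simp at h ⊢
    linear_combination - h
  have key : ∀ N : ℕ, ∑ k ∈ Finset.range (N + 1),
      ((x + γ) * (meixnerCoeff γ μ n k * poch (-(x + 1)) k - meixnerCoeff γ μ n k * poch (-x) k)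
        - (n * (meixnerCoeff γ μ n k * poch (-x) k)
        + n * (n + γ - 1) / (1 - μ) * (meixnerCoeff γ μ (n - 1) k * poch (-x) k)))
      = ((N : ℝ) - n) * (1 - μ⁻¹) * meixnerCoeff γ μ n N * poch (-x) N := by
    intro N
    induction N with
    | zero =>
      simp only [zero_add, Finset.sum_range_one]
      rw [← mul_assoc (n * (n + γ - 1) / (1 - μ)), hβ]
      simp only [poch, Finset.prod_range_zero]
      push_cast
      ring
    | succ N ih =>
      rw [Finset.sum_range_succ, ih, ← mul_assoc (n * (n + γ - 1) / (1 - μ)), hβ,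
        poch_neg_add_one]
      have h := meixnerCoeff_succ_right (μ := μ) hγ n N
      have h' := mul_poch_neg_eq x N
      push_cast
      linear_combination - poch (-x) N * h -
        meixnerCoeff γ μ n (N + 1) * (N + 1) * h'
  have h := key n
  rw [sub_self, zero_mul, zero_mul, zero_mul] at h
  rw [MeixnerM_eq_sum γ μ (show n < n + 1 by omega), MeixnerM_eq_sum γ μ (show n < n + 1 by omega),
    MeixnerM_eq_sum γ μ (show n - 1 < n + 1 by omega), ← Finset.sum_sub_distrib, Finset.mul_sum,
    Finset.mul_sum, Finset.mul_sum, ← Finset.sum_add_distrib, ← sub_eq_zero,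
    ← Finset.sum_sub_distrib, h]

lemma meixner_zero (γ μ x : ℝ) : MeixnerM γ μ 0 x = 1 := by
  simp [MeixnerM, poch]

lemma betaR_zero (γ μ : ℝ) : betaR γ μ 0 = 0 := by simp [betaR]

lemma betaR_pos {γ μ : ℝ} (hγ : 0 < γ) (hμ0 : 0 < μ) (hμ1 : μ < 1) (n : ℕ) :
    0 < betaR γ μ (n + 1) := by
  have h1 : 0 < 1 - μ := by linarith
  have h2 : (0 : ℝ) < ((n + 1 : ℕ) : ℝ) + γ - 1 := by
    push_cast
    have : (0 : ℝ) ≤ n := n.cast_nonneg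
    linarith
  unfold betaR
  positivity

/-- The monic Meixner polynomials as elements of `ℝ[X]`, given by their recurrence. -/
def meixnerPoly (γ μ : ℝ) : ℕ → ℝ[X]
  | 0 => 1
  | 1 => X - C (alphaR γ μ 0)
  | n + 2 => (X - C (alphaR γ μ (n + 1))) * meixnerPoly γ μ (n + 1)
      - C (betaR γ μ (n + 1)) * meixnerPoly γ μ n

lemma meixnerPoly_eval {γ μ : ℝ} (hγ : 0 < γ) (hμ0 : 0 < μ) (hμ1 : μ < 1) (x : ℝ) :
    ∀ n : ℕ, (meixnerPoly γ μ n).eval x = MeixnerM γ μ n x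
  | 0 => by simp [meixnerPoly, meixner_zero]
  | 1 => by
    have h := meixner_recurrence hγ hμ0 hμ1 0 x
    simp only [betaR_zero, meixner_zero, zero_mul, add_zero, mul_one, zero_add] at h
    simp only [meixnerPoly, eval_sub, eval_X, eval_C]
    linear_combination h
  | n + 2 => by
    have h := meixner_recurrence hγ hμ0 hμ1 (n + 1) x
    have h1 := meixnerPoly_eval hγ hμ0 hμ1 x n
    have h2 := meixnerPoly_eval hγ hμ0 hμ1 x (n + 1)
    simp only [meixnerPoly, eval_sub, eval_mul, eval_X, eval_C, h1, h2]
    simp only [Nat.add_sub_cancel] at h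
    linear_combination h

lemma meixnerPoly_recurrence (γ μ : ℝ) (n : ℕ) :
    X * meixnerPoly γ μ n = meixnerPoly γ μ (n + 1) + C (alphaR γ μ n) * meixnerPoly γ μ n
      + C (betaR γ μ n) * meixnerPoly γ μ (n - 1) := by
  rcases n with _ | n
  · simp [meixnerPoly, betaR_zero]
  · simp only [meixnerPoly, Nat.add_sub_cancel]; ring

lemma meixnerPoly_monic_natDegree (γ μ : ℝ) :
    ∀ n : ℕ, (meixnerPoly γ μ n).Monic ∧ (meixnerPoly γ μ n).natDegree = n
  | 0 => by simp [meixnerPoly]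
  | 1 => by
    simp only [meixnerPoly]
    exact ⟨monic_X_sub_C _, natDegree_X_sub_C _⟩
  | n + 2 => by
    obtain ⟨h1, h2⟩ := meixnerPoly_monic_natDegree γ μ n
    obtain ⟨h3, h4⟩ := meixnerPoly_monic_natDegree γ μ (n + 1)
    have h5 : ((X - C (alphaR γ μ (n + 1))) * meixnerPoly γ μ (n + 1)).Monic :=
      (monic_X_sub_C _).mul h3
    have h6 : ((X - C (alphaR γ μ (n + 1))) * meixnerPoly γ μ (n + 1)).natDegree = n + 2 := by
      rw [(monic_X_sub_C _).natDegree_mul h3, natDegree_X_sub_C, h4]; omega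
    have h7 : (C (betaR γ μ (n + 1)) * meixnerPoly γ μ n).natDegree
        < ((X - C (alphaR γ μ (n + 1))) * meixnerPoly γ μ (n + 1)).natDegree := by
      rw [h6]
      exact lt_of_le_of_lt (natDegree_C_mul_le _ _) (by omega)
    have h8 := degree_lt_degree h7
    exact ⟨h5.sub_of_left h8, by
      rw [meixnerPoly, natDegree_sub_eq_left_of_natDegree_lt h7, h6]⟩

/-- Meixner weight. -/
def meixnerWeight (γ μ : ℝ) (x : ℕ) : ℝ := μ ^ x * poch γ x / (Nat.factorial x : ℝ)

lemma meixnerWeight_pos {γ μ : ℝ} (hγ : 0 < γ) (hμ0 : 0 < μ) (x : ℕ) :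
    0 < meixnerWeight γ μ x := by
  have := poch_pos hγ x
  unfold meixnerWeight
  positivity

/-- Pearson equation for the Meixner weight. -/
lemma meixnerWeight_succ (γ μ : ℝ) (x : ℕ) :
    ((x : ℝ) + 1) * meixnerWeight γ μ (x + 1) = μ * (x + γ) * meixnerWeight γ μ x := by
  have h3 : (x : ℝ) + 1 ≠ 0 := by positivity
  have h4 : (Nat.factorial x : ℝ) ≠ 0 := by positivity
  simp only [meixnerWeight, poch_succ, Nat.factorial_succ, pow_succ]
  push_cast
  field_simp
  ring

lemma summable_pow_mul_meixnerWeight {γ μ : ℝ} (hγ : 0 < γ) (hμ0 : 0 < μ) (hμ1 : μ < 1)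
    (k : ℕ) : Summable fun x : ℕ => (x : ℝ) ^ k * meixnerWeight γ μ x := by
  refine summable_of_ratio_test_tendsto_lt_one hμ1 ?_ ?_
  · filter_upwards [eventually_gt_atTop 0] with x hx
    have := meixnerWeight_pos hγ hμ0 x
    positivity
  · have hinv : Tendsto (fun x : ℕ => ((x : ℝ))⁻¹) atTop (𝓝 0) :=
      tendsto_inv_atTop_zero.comp tendsto_natCast_atTop_atTop
    have h : Tendsto (fun x : ℕ => (1 + (x : ℝ)⁻¹) ^ k *
        (μ * (1 + γ * (x : ℝ)⁻¹) / (1 + (x : ℝ)⁻¹))) atTop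
        (𝓝 ((1 + 0) ^ k * (μ * (1 + γ * 0) / (1 + 0)))) := by
      refine ((hinv.const_add 1).pow k).mul (Tendsto.div ?_ (hinv.const_add 1) (by norm_num))
      exact ((hinv.const_mul γ).const_add 1).const_mul μ
    simp only [add_zero, one_pow, mul_zero, mul_one, one_mul, div_one] at h
    refine h.congr' ?_
    filter_upwards [eventually_gt_atTop 0] with x hx
    have h1 := meixnerWeight_pos hγ hμ0 x
    have h2 := meixnerWeight_pos hγ hμ0 (x + 1)
    have h3 := meixnerWeight_succ γ μ x
    have hx' : (0 : ℝ) < x := by exact_mod_cast hx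
    rw [Real.norm_of_nonneg (by positivity), Real.norm_of_nonneg (by positivity)]
    have h4 : meixnerWeight γ μ (x + 1) = μ * (x + γ) * meixnerWeight γ μ x / (x + 1) := by
      rw [← h3]; field_simp
    rw [h4, show (1 : ℝ) + (x : ℝ)⁻¹ = (x + 1) / x by field_simp, div_pow]
    push_cast
    field_simp

lemma summable_eval_mul_meixnerWeight {γ μ : ℝ} (hγ : 0 < γ) (hμ0 : 0 < μ) (hμ1 : μ < 1)
    (p : ℝ[X]) : Summable fun x : ℕ => p.eval (x : ℝ) * meixnerWeight γ μ x := by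
  induction p using Polynomial.induction_on' with
  | add p q hp hq => simpa [add_mul] using hp.add hq
  | monomial k a =>
    simpa [mul_assoc] using (summable_pow_mul_meixnerWeight hγ hμ0 hμ1 k).mul_left a

/-- Meixner moment functional. -/
def meixnerFunctional {γ μ : ℝ} (hγ : 0 < γ) (hμ0 : 0 < μ) (hμ1 : μ < 1) : ℝ[X] →ₗ[ℝ] ℝ where
  toFun p := ∑' x : ℕ, p.eval (x : ℝ) * meixnerWeight γ μ x
  map_add' p q := by
    simp only [eval_add, add_mul]
    exact (summable_eval_mul_meixnerWeight hγ hμ0 hμ1 p).tsum_add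
      (summable_eval_mul_meixnerWeight hγ hμ0 hμ1 q)
  map_smul' a p := by
    simp only [eval_smul, smul_eq_mul, mul_assoc, tsum_mul_left, RingHom.id_apply]

lemma mIP_eq_functional {γ μ : ℝ} (hγ : 0 < γ) (hμ0 : 0 < μ) (hμ1 : μ < 1)
    (p q : ℝ[X]) :
    mIP γ μ (fun x => p.eval x) (fun x => q.eval x)
      = meixnerFunctional hγ hμ0 hμ1 (p * q) := by
  simp only [mIP, meixnerFunctional, LinearMap.coe_mk, AddHom.coe_mk, eval_mul, meixnerWeight]
  exact tsum_congr fun x => by ring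

lemma functional_C_mul {γ μ : ℝ} (hγ : 0 < γ) (hμ0 : 0 < μ) (hμ1 : μ < 1)
    (a : ℝ) (p : ℝ[X]) :
    meixnerFunctional hγ hμ0 hμ1 (C a * p) = a * meixnerFunctional hγ hμ0 hμ1 p := by
  rw [← smul_eq_C_mul, map_smul, smul_eq_mul]

lemma functional_pearson {γ μ : ℝ} (hγ : 0 < γ) (hμ0 : 0 < μ) (hμ1 : μ < 1)
    (p : ℝ[X]) :
    meixnerFunctional hγ hμ0 hμ1 (X * p)
      = meixnerFunctional hγ hμ0 hμ1 (C μ * (X + C γ) * p.comp (X + 1)) := by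
  simp only [meixnerFunctional, LinearMap.coe_mk, AddHom.coe_mk]
  rw [(summable_eval_mul_meixnerWeight hγ hμ0 hμ1 (X * p)).tsum_eq_zero_add]
  simp only [eval_mul, eval_X, Nat.cast_zero, zero_mul, zero_add, eval_C, eval_add, eval_comp,
    eval_one]
  refine tsum_congr fun x => ?_
  have := meixnerWeight_succ γ μ x
  push_cast
  linear_combination p.eval ((x : ℝ) + 1) * this

lemma functional_meixnerPoly_eq_zero {γ μ : ℝ} (hγ : 0 < γ) (hμ0 : 0 < μ) (hμ1 : μ < 1)
    (n : ℕ) :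
    meixnerFunctional hγ hμ0 hμ1 (meixnerPoly γ μ (n + 1)) = 0 := by
  set P := meixnerPoly γ μ (n + 1) with hP
  have h1 := functional_pearson hγ hμ0 hμ1 P
  have h2 := functional_pearson hγ hμ0 hμ1 (P.comp (X - 1))
  have h3 : (P.comp (X - 1)).comp (X + 1) = P := by simp [comp_assoc]
  rw [h3] at h2
  have key : C ((n + 1 : ℝ) * (μ - 1)) * P = C μ * (X + C γ) * P.comp (X + 1)
      - C μ * (X + C γ) * P - (X * P - X * P.comp (X - 1)) := by
    refine Polynomial.funext fun x => ?_
    have hf := meixner_forward_structure hγ hμ0 hμ1 (n + 1) x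
    have hb := meixner_backward_structure γ μ (n + 1) x
    simp only [hP, eval_mul, eval_C, eval_sub, eval_add, eval_X, eval_comp, eval_one,
      meixnerPoly_eval hγ hμ0 hμ1]
    push_cast at hf hb
    linear_combination -μ * hf + hb
  have h4 := functional_C_mul hγ hμ0 hμ1 ((n + 1 : ℝ) * (μ - 1)) P
  rw [key, map_sub, map_sub, map_sub, ← h1, h2, sub_self] at h4
  have h5 : ((n + 1 : ℝ) * (μ - 1)) ≠ 0 := mul_ne_zero (by positivity) (by linarith)
  exact (mul_eq_zero.1 h4.symm).resolve_left h5

lemma functional_meixnerPoly_mul_X_pow {γ μ : ℝ} (hγ : 0 < γ) (hμ0 : 0 < μ) (hμ1 : μ < 1)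
    (k : ℕ) :
    ∀ n, k < n → meixnerFunctional hγ hμ0 hμ1 (meixnerPoly γ μ n * X ^ k) = 0 := by
  induction k with
  | zero =>
    intro n hn
    obtain ⟨m, rfl⟩ := Nat.exists_eq_succ_of_ne_zero hn.ne'
    simpa using functional_meixnerPoly_eq_zero hγ hμ0 hμ1 m
  | succ k ih =>
    intro n hn
    have : meixnerPoly γ μ n * X ^ (k + 1) = meixnerPoly γ μ (n + 1) * X ^ k
        + C (alphaR γ μ n) * (meixnerPoly γ μ n * X ^ k)
        + C (betaR γ μ n) * (meixnerPoly γ μ (n - 1) * X ^ k) := by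
      linear_combination X ^ k * meixnerPoly_recurrence γ μ n
    rw [this, map_add, map_add, functional_C_mul, functional_C_mul, ih _ (by omega),
      ih _ (by omega), ih _ (by omega)]
    simp

lemma functional_meixnerPoly_mul_of_natDegree_lt {γ μ : ℝ} (hγ : 0 < γ) (hμ0 : 0 < μ) (hμ1 : μ < 1)
    {n : ℕ} {p : ℝ[X]} (hp : p.degree < n) :
    meixnerFunctional hγ hμ0 hμ1 (meixnerPoly γ μ n * p) = 0 := by
  rcases eq_or_ne p 0 with rfl | h0
  · simp
  have hp' : p.natDegree < n := (natDegree_lt_iff_degree_lt h0).2 hp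
  rw [p.as_sum_range_C_mul_X_pow, Finset.mul_sum, map_sum]
  refine Finset.sum_eq_zero fun k hk => ?_
  rw [mul_left_comm, functional_C_mul, functional_meixnerPoly_mul_X_pow hγ hμ0 hμ1 k n
    (by rw [Finset.mem_range] at hk; omega), mul_zero]

lemma meixnerPoly_degree (γ μ : ℝ) (n : ℕ) : (meixnerPoly γ μ n).degree = n := by
  obtain ⟨h1, h2⟩ := meixnerPoly_monic_natDegree γ μ n
  rw [degree_eq_natDegree h1.ne_zero, h2]

lemma nrm2_eq_functional {γ μ : ℝ} (hγ : 0 < γ) (hμ0 : 0 < μ) (hμ1 : μ < 1)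
    (n : ℕ) :
    nrm2 γ μ n = meixnerFunctional hγ hμ0 hμ1 (meixnerPoly γ μ n * meixnerPoly γ μ n) := by
  rw [← mIP_eq_functional hγ hμ0 hμ1, nrm2]
  simp only [meixnerPoly_eval hγ hμ0 hμ1]

lemma nrm2_succ {γ μ : ℝ} (hγ : 0 < γ) (hμ0 : 0 < μ) (hμ1 : μ < 1)
    (n : ℕ) : nrm2 γ μ (n + 1) = betaR γ μ (n + 1) * nrm2 γ μ n := by
  have h1 := meixnerPoly_recurrence γ μ n
  have h2 := meixnerPoly_recurrence γ μ (n + 1)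
  have e : meixnerPoly γ μ (n + 1) * meixnerPoly γ μ (n + 1)
      = meixnerPoly γ μ (n + 2) * meixnerPoly γ μ n
      + C (alphaR γ μ (n + 1)) * (meixnerPoly γ μ (n + 1) * meixnerPoly γ μ n)
      + C (betaR γ μ (n + 1)) * (meixnerPoly γ μ n * meixnerPoly γ μ n)
      - C (alphaR γ μ n) * (meixnerPoly γ μ (n + 1) * meixnerPoly γ μ n)
      - C (betaR γ μ n) * (meixnerPoly γ μ (n + 1) * meixnerPoly γ μ (n - 1)) := by
    simp only [Nat.add_sub_cancel] at h2
    linear_combination meixnerPoly γ μ n * h2 - meixnerPoly γ μ (n + 1) * h1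
  have o : ∀ m k : ℕ, k < m → meixnerFunctional hγ hμ0 hμ1
      (meixnerPoly γ μ m * meixnerPoly γ μ k) = 0 := fun m k hk =>
    functional_meixnerPoly_mul_of_natDegree_lt hγ hμ0 hμ1 (by
      rw [meixnerPoly_degree]; exact_mod_cast hk)
  rw [nrm2_eq_functional hγ hμ0 hμ1, nrm2_eq_functional hγ hμ0 hμ1, e, map_sub, map_sub, map_add,
    map_add]
  simp only [functional_C_mul]
  rw [o (n + 2) n (by omega), o (n + 1) n (by omega), o (n + 1) (n - 1) (by omega)]
  ring

lemma nrm2_pos {γ μ : ℝ} (hγ : 0 < γ) (hμ0 : 0 < μ) (hμ1 : μ < 1)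
    (n : ℕ) : 0 < nrm2 γ μ n := by
  induction n with
  | zero =>
    have h := summable_eval_mul_meixnerWeight hγ hμ0 hμ1 1
    rw [nrm2_eq_functional hγ hμ0 hμ1]
    simp only [meixnerPoly, mul_one, meixnerFunctional, LinearMap.coe_mk, AddHom.coe_mk]
    refine h.tsum_pos (fun x => ?_) 0 ?_
    · simpa using (meixnerWeight_pos hγ hμ0 x).le
    · simpa using meixnerWeight_pos hγ hμ0 0
  | succ n ih =>
    rw [nrm2_succ hγ hμ0 hμ1]
    exact mul_pos (betaR_pos hγ hμ0 hμ1 n) ih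

lemma eq_zero_of_orthogonal_meixnerPoly {γ μ : ℝ} (hγ : 0 < γ) (hμ0 : 0 < μ) (hμ1 : μ < 1)
    (n : ℕ) : ∀ p : ℝ[X], p.degree < n →
    (∀ k < n, meixnerFunctional hγ hμ0 hμ1 (meixnerPoly γ μ k * p) = 0) → p = 0 := by
  induction n with
  | zero =>
    intro p hp _
    simpa using hp
  | succ n ih =>
    intro p hp ho
    have hd : (p - C (p.coeff n) * meixnerPoly γ μ n).degree < n := by
      obtain ⟨h1, h2⟩ := meixnerPoly_monic_natDegree γ μ n
      rw [degree_lt_iff_coeff_zero] at hp ⊢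
      intro m hm
      rcases eq_or_lt_of_le hm with rfl | hm
      · have := h1.coeff_natDegree
        rw [h2] at this
        simp [this]
      · simp [hp m hm, coeff_eq_zero_of_natDegree_lt (h2.trans_lt hm)]
    have h0 := ih _ hd fun k hk => by
      rw [mul_sub, map_sub, ho k (by omega), mul_left_comm, functional_C_mul,
        mul_comm (meixnerPoly γ μ k), functional_meixnerPoly_mul_of_natDegree_lt hγ hμ0 hμ1
          (by rw [meixnerPoly_degree]; exact_mod_cast hk)]
      simp
    have hp' := sub_eq_zero.1 h0
    have h1 := ho n (by omega)
    rw [hp', mul_left_comm, functional_C_mul, ← nrm2_eq_functional hγ hμ0 hμ1] at h1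
    rw [hp', (mul_eq_zero.1 h1).resolve_right (nrm2_pos hγ hμ0 hμ1 n).ne']
    simp

lemma Dk_succ (i k : ℕ) (f : ℝ → ℝ) : Dk i (k + 1) f = Dop i (Dk i k f) :=
  Function.iterate_succ_apply' _ _ _

lemma Dop_linear_comb (i : ℕ) (a b : ℝ) (f g : ℝ → ℝ) :
    Dop i (fun t => a * f t + b * g t) = fun t => a * Dop i f t + b * Dop i g t := by
  funext x
  simp only [Dop]
  split_ifs <;> ring

lemma Dk_linear_comb (i k : ℕ) (a b : ℝ) (f g : ℝ → ℝ) :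
    Dk i k (fun t => a * f t + b * g t) = fun t => a * Dk i k f t + b * Dk i k g t := by
  induction k with
  | zero => rfl
  | succ k ih => rw [Dk_succ, ih, Dop_linear_comb, Dk_succ, Dk_succ]

lemma Dk_sum {ι : Type*} (i k : ℕ) (s : Finset ι) (c : ι → ℝ) (f : ι → ℝ → ℝ) (x : ℝ) :
    Dk i k (fun t => ∑ m ∈ s, c m * f m t) x = ∑ m ∈ s, c m * Dk i k (f m) x := by
  classical
  induction s using Finset.induction_on with
  | empty =>
    have h := congrFun (Dk_linear_comb i k 0 0 (fun _ => 0) (fun _ => 0)) x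
    simpa using h
  | insert m s hm ih =>
    simp only [Finset.sum_insert hm]
    have h := congrFun (Dk_linear_comb i k (c m) 1 (f m) (fun t => ∑ m ∈ s, c m * f m t)) x
    simp only [one_mul] at h
    rw [h, ih]

/-- The direction `±1` in which `𝒟_i` shifts. -/
def shiftSign (i : ℕ) : ℝ := if i = 1 then 1 else -1

lemma br_succ (i : ℕ) (x : ℝ) (k : ℕ) : br i x (k + 1) = br i x k * (x - k * shiftSign i) := by
  simp only [br, shiftSign, fall, poch, Finset.prod_range_succ]
  split_ifs <;> ring

lemma Dop_eq_shift (i : ℕ) (f : ℝ → ℝ) (x : ℝ) :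
    Dop i f x = shiftSign i * (f (x + shiftSign i) - f x) := by
  simp only [Dop, shiftSign]
  split_ifs
  · ring
  · rw [← sub_eq_add_neg]; ring

lemma shiftSign_mul_self (i : ℕ) : shiftSign i * shiftSign i = 1 := by
  simp only [shiftSign]
  split_ifs <;> norm_num

/-- Leibniz rule for `𝒟_i^k` applied to a product with a linear factor. -/
lemma Dk_linear_mul (i : ℕ) (x : ℝ) (h : ℝ → ℝ) (k : ℕ) :
    Dk i k (fun y => (x - y) * h y) = fun y =>
      (x - y - k * shiftSign i) * Dk i k h y - k * Dk i (k - 1) h y := by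
  have step : ∀ (a b : ℝ) (φ ψ : ℝ → ℝ) (y : ℝ),
      Dop i (fun y => (x - y - a * shiftSign i) * φ y - b * ψ y) y
        = (x - y - (a + 1) * shiftSign i) * Dop i φ y - φ y - b * Dop i ψ y := by
    intro a b φ ψ y
    simp only [Dop_eq_shift]
    linear_combination -φ y * shiftSign_mul_self i
  induction k with
  | zero => funext y; simp [Dk]
  | succ k ih =>
    funext y
    rw [Dk_succ, ih, step]
    rcases k with _ | k
    · simp [Dk_succ]
    · simp only [Nat.add_sub_cancel, ← Dk_succ]
      push_cast
      ring

lemma br_mul_Dk (i : ℕ) (x α : ℝ) (h : ℝ → ℝ) (j : ℕ) :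
    br i (x - α) (j + 1) * Dk i j h α = (Nat.factorial j : ℝ) *
      ∑ k ∈ Finset.range (j + 1),
        Dk i k (fun y => (x - y) * h y) α / (Nat.factorial k : ℝ) * br i (x - α) k := by
  induction j with
  | zero => simp [Dk, br_succ]; simp [br, fall, poch]
  | succ j ih =>
    have h4 : (Nat.factorial j : ℝ) ≠ 0 := by positivity
    have h3 : (j : ℝ) + 1 ≠ 0 := by positivity
    rw [Finset.sum_range_succ, mul_add, Nat.factorial_succ, Nat.cast_mul, mul_assoc, ← ih,
      Dk_linear_mul, br_succ _ _ (j + 1)]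
    simp only [Nat.add_sub_cancel]
    push_cast
    field_simp
    ring


/-- Christoffel–Darboux formula for the Meixner polynomials. -/
lemma meixner_christoffel_darboux {γ μ : ℝ} (hγ : 0 < γ) (hμ0 : 0 < μ) (hμ1 : μ < 1) (x y : ℝ)
    (n : ℕ) :
    (x - y) * ∑ k ∈ Finset.range (n + 1), MeixnerM γ μ k x * MeixnerM γ μ k y / nrm2 γ μ k
      = (MeixnerM γ μ (n + 1) x * MeixnerM γ μ n y - MeixnerM γ μ n x * MeixnerM γ μ (n + 1) y)
        / nrm2 γ μ n := by
  induction n with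
  | zero =>
    have h1 := meixner_recurrence hγ hμ0 hμ1 0 x
    have h2 := meixner_recurrence hγ hμ0 hμ1 0 y
    simp only [meixner_zero, betaR_zero, zero_add] at h1 h2
    simp only [zero_add, Finset.sum_range_one, meixner_zero]
    linear_combination (nrm2 γ μ 0)⁻¹ * (h1 - h2)
  | succ n ih =>
    have h1 := meixner_recurrence hγ hμ0 hμ1 (n + 1) x
    have h2 := meixner_recurrence hγ hμ0 hμ1 (n + 1) y
    have hn := (nrm2_pos hγ hμ0 hμ1 n).ne'
    have hb := (betaR_pos hγ hμ0 hμ1 n).ne'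
    simp only [Nat.add_sub_cancel] at h1 h2
    rw [Finset.sum_range_succ, mul_add, ih, nrm2_succ hγ hμ0 hμ1]
    field_simp
    linear_combination MeixnerM γ μ (n + 1) y * h1 - MeixnerM γ μ (n + 1) x * h2

lemma br_mul_Klm {γ μ : ℝ} (hγ : 0 < γ) (hμ0 : 0 < μ) (hμ1 : μ < 1) (i j n : ℕ) (x α : ℝ) :
    br i (x - α) (j + 1) * Klm γ μ i 0 j n x α = (Nat.factorial j : ℝ) *
      ∑ k ∈ Finset.range (j + 1), (MeixnerM γ μ (n + 1) x * Dk i k (MeixnerM γ μ n) α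
        - MeixnerM γ μ n x * Dk i k (MeixnerM γ μ (n + 1)) α) / nrm2 γ μ n
        / (Nat.factorial k : ℝ) * br i (x - α) k := by
  have h := br_mul_Dk i x α (fun y => ∑ k ∈ Finset.range (n + 1),
    MeixnerM γ μ k x / nrm2 γ μ k * MeixnerM γ μ k y) j
  have hK : Dk i j (fun y => ∑ k ∈ Finset.range (n + 1),
      MeixnerM γ μ k x / nrm2 γ μ k * MeixnerM γ μ k y) α = Klm γ μ i 0 j n x α := by
    rw [Dk_sum, Klm]
    refine Finset.sum_congr rfl fun k _ => ?_
    change _ = MeixnerM γ μ k x * _ / _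
    ring
  have hcd : (fun y => (x - y) * ∑ k ∈ Finset.range (n + 1),
      MeixnerM γ μ k x / nrm2 γ μ k * MeixnerM γ μ k y) = fun y =>
        (MeixnerM γ μ (n + 1) x / nrm2 γ μ n) * MeixnerM γ μ n y
        + (-(MeixnerM γ μ n x / nrm2 γ μ n)) * MeixnerM γ μ (n + 1) y := by
    funext y
    have h := meixner_christoffel_darboux hγ hμ0 hμ1 x y n
    simp only [div_mul_eq_mul_div]
    rw [h]
    ring
  rw [hK, hcd] at h
  rw [h]
  congr 1
  refine Finset.sum_congr rfl fun k _ => ?_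
  rw [Dk_linear_comb]
  ring

lemma one_add_Klm_pos {γ μ lam : ℝ} (hγ : 0 < γ) (hμ0 : 0 < μ) (hμ1 : μ < 1) (hlam : 0 < lam)
    (i j n : ℕ) (α : ℝ) : 0 < 1 + lam * Klm γ μ i j j n α α := by
  have : 0 ≤ Klm γ μ i j j n α α := Finset.sum_nonneg fun k _ =>
    div_nonneg (mul_self_nonneg _) (nrm2_pos hγ hμ0 hμ1 k).le
  positivity

/-- Expansion of the Sobolev polynomial through the Meixner kernel. -/
lemma sobolev_eq_sub_Klm {γ μ lam α : ℝ} (hγ : 0 < γ) (hμ0 : 0 < μ) (hμ1 : μ < 1) {i j n : ℕ}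
    {Q : ℝ[X]} (hQ : IsSobolevOP γ μ lam α i j (n + 1) Q) (x : ℝ) :
    Q.eval x = MeixnerM γ μ (n + 1) x
      - lam * Dk i j (fun t => Q.eval t) α * Klm γ μ i 0 j n x α := by
  obtain ⟨hmon, hdeg, horth⟩ := hQ
  set d := Dk i j (fun t => Q.eval t) α with hd
  obtain ⟨hP1, hP2⟩ := meixnerPoly_monic_natDegree γ μ (n + 1)
  set S : ℝ[X] := ∑ k ∈ Finset.range (n + 1),
    C (Dk i j (MeixnerM γ μ k) α / nrm2 γ μ k) * meixnerPoly γ μ k with hS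
  have hR : Q - meixnerPoly γ μ (n + 1) + C (lam * d) * S = 0 := by
    refine eq_zero_of_orthogonal_meixnerPoly hγ hμ0 hμ1 (n + 1) _ ?_ fun k hk => ?_
    · have hQd : Q.degree = (meixnerPoly γ μ (n + 1)).degree := by
        rw [meixnerPoly_degree, degree_eq_natDegree hmon.ne_zero, hdeg]
      have h1 : (Q - meixnerPoly γ μ (n + 1)).degree < (n + 1 : ℕ) := by
        refine (degree_sub_lt_left hQd hmon.ne_zero ?_).trans_eq ?_
        · rw [hmon.leadingCoeff, hP1.leadingCoeff]
        · rw [hQd, meixnerPoly_degree]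
      rw [← mem_degreeLT] at h1 ⊢
      refine add_mem h1 ?_
      rw [← smul_eq_C_mul]
      refine Submodule.smul_mem _ _ (Submodule.sum_mem _ fun k hk => ?_)
      rw [← smul_eq_C_mul]
      refine Submodule.smul_mem _ _ ?_
      rw [mem_degreeLT, meixnerPoly_degree]
      exact_mod_cast Finset.mem_range.1 hk
    · have hkd : (meixnerPoly γ μ k).degree < (n + 1 : ℕ) := by
        rw [meixnerPoly_degree]; exact_mod_cast hk
      have h1 := horth _ hkd
      have hfun : (fun x => (meixnerPoly γ μ k).eval x) = MeixnerM γ μ k :=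
        funext fun x => meixnerPoly_eval hγ hμ0 hμ1 x k
      rw [sIP, mIP_eq_functional hγ hμ0 hμ1, hfun, ← hd] at h1
      have h2 := functional_meixnerPoly_mul_of_natDegree_lt hγ hμ0 hμ1 hkd
      have h3 : meixnerFunctional hγ hμ0 hμ1 (meixnerPoly γ μ k * S)
          = Dk i j (MeixnerM γ μ k) α := by
        rw [hS, Finset.mul_sum, map_sum, Finset.sum_eq_single_of_mem k (Finset.mem_range.2 hk)]
        · rw [mul_left_comm, functional_C_mul, ← nrm2_eq_functional]
          exact div_mul_cancel₀ _ (nrm2_pos hγ hμ0 hμ1 k).ne'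
        · intro m _ hmk
          rw [mul_left_comm, functional_C_mul]
          rcases lt_or_gt_of_ne hmk with h | h
          · rw [functional_meixnerPoly_mul_of_natDegree_lt hγ hμ0 hμ1
              (by rw [meixnerPoly_degree]; exact_mod_cast h), mul_zero]
          · rw [mul_comm (meixnerPoly γ μ k),
              functional_meixnerPoly_mul_of_natDegree_lt hγ hμ0 hμ1
              (by rw [meixnerPoly_degree]; exact_mod_cast h), mul_zero]
      rw [mul_add, mul_sub, map_add, map_sub, mul_left_comm, functional_C_mul, h3,
        mul_comm _ Q, mul_comm _ (meixnerPoly γ μ (n + 1)), h2]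
      linear_combination h1
  have h := congrArg (fun p => p.eval x) hR
  have hSx : S.eval x = Klm γ μ i 0 j n x α := by
    rw [hS, eval_finsetSum, Klm]
    refine Finset.sum_congr rfl fun k _ => ?_
    rw [eval_mul, eval_C, meixnerPoly_eval hγ hμ0 hμ1]
    change _ = MeixnerM γ μ k x * _ / _
    ring
  simp only [eval_add, eval_sub, eval_mul, eval_C, eval_zero, hSx,
    meixnerPoly_eval hγ hμ0 hμ1] at h
  linear_combination h

lemma sobolev_Dk_mul {γ μ lam α : ℝ} (hγ : 0 < γ) (hμ0 : 0 < μ) (hμ1 : μ < 1) {i j n : ℕ}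
    {Q : ℝ[X]} (hQ : IsSobolevOP γ μ lam α i j (n + 1) Q) :
    Dk i j (fun t => Q.eval t) α * (1 + lam * Klm γ μ i j j n α α)
      = Dk i j (MeixnerM γ μ (n + 1)) α := by
  set d := Dk i j (fun t => Q.eval t) α with hd
  have hfun : (fun t => Q.eval t) = fun t => 1 * MeixnerM γ μ (n + 1) t + (-(lam * d)) *
      ∑ k ∈ Finset.range (n + 1),
        Dk i j (MeixnerM γ μ k) α / nrm2 γ μ k * MeixnerM γ μ k t := by
    funext t
    rw [sobolev_eq_sub_Klm hγ hμ0 hμ1 hQ t, ← hd, Klm]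
    rw [one_mul, neg_mul, ← sub_eq_add_neg]
    congr 2
    refine Finset.sum_congr rfl fun k _ => ?_
    change MeixnerM γ μ k t * _ / _ = _
    ring
  have h := hd
  rw [hfun, Dk_linear_comb] at h
  beta_reduce at h
  rw [Dk_sum] at h
  have hK : Klm γ μ i j j n α α = ∑ k ∈ Finset.range (n + 1),
      Dk i j (MeixnerM γ μ k) α / nrm2 γ μ k * Dk i j (MeixnerM γ μ k) α :=
    Finset.sum_congr rfl fun k _ => by ring
  rw [← hK] at h
  linear_combination h

/-- Connection formula between Sobolev and Meixner polynomials. -/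
lemma sobolev_connection {γ μ lam α : ℝ} (hγ : 0 < γ) (hμ0 : 0 < μ) (hμ1 : μ < 1)
    (hlam : 0 < lam) {i j n : ℕ} {Q : ℝ[X]} (hQ : IsSobolevOP γ μ lam α i j (n + 1) Q) {x : ℝ}
    (hbr : br i (x - α) (j + 1) ≠ 0) :
    Q.eval x = A1 γ μ lam α i j (n + 1) x * MeixnerM γ μ (n + 1) x
      + B1 γ μ lam α i j (n + 1) x * MeixnerM γ μ n x := by
  have hpos := (one_add_Klm_pos hγ hμ0 hμ1 hlam i j n α).ne'
  have hd := eq_div_of_mul_eq hpos (sobolev_Dk_mul hγ hμ0 hμ1 hQ)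
  have hK := br_mul_Klm hγ hμ0 hμ1 i j n x α
  rw [mul_comm, ← eq_div_iff hbr] at hK
  rw [sobolev_eq_sub_Klm hγ hμ0 hμ1 hQ x, hd, hK, A1, B1, add_mul, one_mul, sub_eq_add_neg,
    add_assoc]
  congr 1
  simp only [Finset.mul_sum, Finset.sum_mul, Finset.sum_div, ← Finset.sum_add_distrib,
    ← Finset.sum_neg_distrib, acoef, bcoef, Nat.add_sub_cancel]
  refine Finset.sum_congr rfl fun k _ => ?_
  have hn := (nrm2_pos hγ hμ0 hμ1 n).ne'
  have hf : (Nat.factorial k : ℝ) ≠ 0 := by positivity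
  field_simp
  ring


/-- Structure relation in the unified notation for `𝒟_i`. -/
lemma meixner_structure {γ μ : ℝ} (hγ : 0 < γ) (hμ0 : 0 < μ) (hμ1 : μ < 1) {i : ℕ}
    (hi : i = 1 ∨ i = 2) (n : ℕ) (x : ℝ) :
    (x + γ * kdelta i 1) * Dop i (MeixnerM γ μ n) x = n * MeixnerM γ μ n x
      + n * (n + γ - 1) * μ ^ kdelta i 2 / (1 - μ) * MeixnerM γ μ (n - 1) x := by
  rcases hi with rfl | rfl
  · simpa [Dop, kdelta] using meixner_forward_structure hγ hμ0 hμ1 n x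
  · simpa [Dop, kdelta] using meixner_backward_structure γ μ n x

lemma Dop_mul (i : ℕ) (f g : ℝ → ℝ) (x : ℝ) :
    Dop i (fun t => f t * g t) x = Dop i f x * g x + f (sh i x) * Dop i g x := by
  simp only [Dop, sh]
  split_ifs <;> ring

lemma Dop_add (i : ℕ) (f g : ℝ → ℝ) (x : ℝ) :
    Dop i (fun t => f t + g t) x = Dop i f x + Dop i g x := by
  simp only [Dop]
  split_ifs <;> ring

lemma Dop_congr {i : ℕ} {f g : ℝ → ℝ} {x : ℝ} (h : f x = g x) (h' : f (sh i x) = g (sh i x)) :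
    Dop i f x = Dop i g x := by
  simp only [Dop, sh] at *
  split_ifs at * <;> rw [h, h']

lemma Dop_connection {γ μ lam α : ℝ} (hγ : 0 < γ) (hμ0 : 0 < μ) (hμ1 : μ < 1) {i : ℕ}
    (hi : i = 1 ∨ i = 2) (j n : ℕ) (x : ℝ) :
    (x + γ * kdelta i 1) * Dop i (fun t => A1 γ μ lam α i j (n + 1) t * MeixnerM γ μ (n + 1) t
      + B1 γ μ lam α i j (n + 1) t * MeixnerM γ μ n t) x
      = C1 γ μ lam α i j (n + 1) x * MeixnerM γ μ (n + 1) x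
        + D1 γ μ lam α i j (n + 1) x * MeixnerM γ μ n x := by
  have h1 := meixner_structure hγ hμ0 hμ1 hi (n + 1) x
  have h2 := meixner_structure hγ hμ0 hμ1 hi n x
  simp only [Dop_add, Dop_mul, C1, D1, Nat.add_sub_cancel, ← div_div]
  simp only [Nat.add_sub_cancel] at h1
  generalize μ ^ kdelta i 2 = m at *
  rcases n with _ | n
  · push_cast at *
    simp only [betaR_zero]
    linear_combination A1 γ μ lam α i j (0 + 1) (sh i x) * h1
      + B1 γ μ lam α i j (0 + 1) (sh i x) * h2
  · have h3 := meixner_recurrence hγ hμ0 hμ1 (n + 1) x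
    have hb := (betaR_pos hγ hμ0 hμ1 n).ne'
    simp only [Nat.add_sub_cancel] at h2 h3
    have h4 : MeixnerM γ μ n x = ((x - alphaR γ μ (n + 1)) * MeixnerM γ μ (n + 1) x
        - MeixnerM γ μ (n + 1 + 1) x) / betaR γ μ (n + 1) := by
      rw [eq_div_iff hb]
      linear_combination -h3
    rw [h4] at h2
    push_cast at *
    linear_combination A1 γ μ lam α i j (n + 1 + 1) (sh i x) * h1
      + B1 γ μ lam α i j (n + 1 + 1) (sh i x) * h2

/-- A combination of `M_{n+1}` and `M_n` rewritten in terms of `M_{n+2}` and `M_{n+1}`. -/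
lemma connection_pred {γ μ : ℝ} (hγ : 0 < γ) (hμ0 : 0 < μ) (hμ1 : μ < 1) (a b : ℝ)
    (n : ℕ) (x : ℝ) :
    a * MeixnerM γ μ (n + 1) x + b * MeixnerM γ μ n x
      = (-b / betaR γ μ (n + 1)) * MeixnerM γ μ (n + 2) x
        + (a + (-b / betaR γ μ (n + 1)) * (alphaR γ μ (n + 1) - x)) * MeixnerM γ μ (n + 1) x := by
  have h3 := meixner_recurrence hγ hμ0 hμ1 (n + 1) x
  have hb := (betaR_pos hγ hμ0 hμ1 n).ne'
  simp only [Nat.add_sub_cancel] at h3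
  field_simp
  linear_combination -b * h3

/-- Eliminating `p` from a pair of first-order relations gives a second-order difference
equation. -/
lemma second_order_of_ladder {i : ℕ} {x : ℝ} {T L11 L21 L12 L22 q p : ℝ → ℝ}
    (h : T x * Dop i q x + L21 x * q x = L11 x * p x)
    (h' : T (sh i x) * Dop i q (sh i x) + L21 (sh i x) * q (sh i x) = L11 (sh i x) * p (sh i x))
    (h2 : T x * Dop i p x + L12 x * p x = L22 x * q x)
    (hL : L11 x ≠ 0) (hL' : L11 (sh i x) ≠ 0) :
    T x * T (sh i x) / L11 (sh i x) * Dk i 2 q x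
      + (T x * Dop i T x / L11 (sh i x) - T x ^ 2 * Dop i L11 x / (L11 x * L11 (sh i x))
        + T x * L21 (sh i x) / L11 (sh i x) + T x * L12 x / L11 x) * Dop i q x
      + (T x * Dop i L21 x / L11 (sh i x) - T x * L21 x * Dop i L11 x / (L11 x * L11 (sh i x))
        + L12 x * L21 x / L11 x - L22 x) * q x = 0 := by
  have hD : Dk i 2 q x = Dop i (Dop i q) x := rfl
  have hf : ∀ f, Dop i f x = shiftSign i * (f (sh i x) - f x) := by
    intro f
    simp only [Dop, shiftSign, sh]
    split_ifs <;> ring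
  have hp : p x = (T x * Dop i q x + L21 x * q x) / L11 x := by
    rw [h]; field_simp
  have hp' : p (sh i x)
      = (T (sh i x) * Dop i q (sh i x) + L21 (sh i x) * q (sh i x)) / L11 (sh i x) := by
    rw [h']; field_simp
  have hq : q (sh i x) = q x + shiftSign i * Dop i q x := by
    rw [hf q]
    linear_combination -(q (sh i x) - q x) * shiftSign_mul_self i
  rw [hf p, hp, hp', hq] at h2
  rw [hD, hf (Dop i q), hf T, hf L11, hf L21]
  have hs := shiftSign_mul_self i
  generalize Dop i q x = d at *
  generalize Dop i q (sh i x) = d' at *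
  generalize shiftSign i = e at *
  rw [← sub_eq_zero] at h2
  refine Eq.trans ?_ h2
  field_simp
  linear_combination (-T x * L11 x * L21 (sh i x) * d) * hs

/-- Ladder relations for two functions given in terms of a common pair `(m, m')`. -/
lemma ladder_of_connection {A1 B1 A2 B2 C D m m' g q p d : ℝ}
    (hq : q = A1 * m + B1 * m') (hp : p = A2 * m + B2 * m') (hd : g * d = C * m + D * m') :
    g * (A1 * B2 - B1 * A2) * d = (C * B2 - A2 * D) * q - (C * B1 - A1 * D) * p := by
  subst hq hp
  linear_combination (A1 * B2 - B1 * A2) * hd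

/-- second order linear difference equation for `Q_n^{(i)}`. -/
theorem sobolev_second_order_difference_equation (γ μ lam α : ℝ) (hγ : 0 < γ) (hμ0 : 0 < μ)
    (hμ1 : μ < 1) (hlam : 0 < lam) (hα : α ≤ 0) (j i n : ℕ) (hi : i = 1 ∨ i = 2)
    (hn : 2 ≤ n) (Q : Polynomial ℝ) (hQ : IsSobolevOP γ μ lam α i j n Q) (x : ℝ)
    (hbr : br i (x - α) (j + 1) ≠ 0) (hbr' : br i (sh i x - α) (j + 1) ≠ 0)
    (hbr'' : br i (sh i (sh i x) - α) (j + 1) ≠ 0)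
    (hL : Lam γ μ lam α i j n 1 1 x ≠ 0) (hL' : Lam γ μ lam α i j n 1 1 (sh i x) ≠ 0)
    (F G H : ℝ)
    (hF : F = Thetatil γ μ lam α i j n x * Thetatil γ μ lam α i j n (sh i x) /
      Lam γ μ lam α i j n 1 1 (sh i x))
    (hG : G = Thetatil γ μ lam α i j n x * Dop i (Thetatil γ μ lam α i j n) x /
          Lam γ μ lam α i j n 1 1 (sh i x)
        - Thetatil γ μ lam α i j n x ^ 2 * Dop i (Lam γ μ lam α i j n 1 1) x /
          (Lam γ μ lam α i j n 1 1 x * Lam γ μ lam α i j n 1 1 (sh i x))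
        + Thetatil γ μ lam α i j n x * Lam γ μ lam α i j n 2 1 (sh i x) /
          Lam γ μ lam α i j n 1 1 (sh i x)
        + Thetatil γ μ lam α i j n x * Lam γ μ lam α i j n 1 2 x /
          Lam γ μ lam α i j n 1 1 x)
    (hH : H = Thetatil γ μ lam α i j n x * Dop i (Lam γ μ lam α i j n 2 1) x /
          Lam γ μ lam α i j n 1 1 (sh i x)
        - Thetatil γ μ lam α i j n x * Lam γ μ lam α i j n 2 1 x *
            Dop i (Lam γ μ lam α i j n 1 1) x /
          (Lam γ μ lam α i j n 1 1 x * Lam γ μ lam α i j n 1 1 (sh i x))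
        + Lam γ μ lam α i j n 1 2 x * Lam γ μ lam α i j n 2 1 x /
          Lam γ μ lam α i j n 1 1 x
        - Lam γ μ lam α i j n 2 2 x) :
    F * Dk i 2 (fun t => Q.eval t) x + G * Dop i (fun t => Q.eval t) x + H * Q.eval x = 0 := by
  obtain ⟨n, rfl⟩ : ∃ k, n = k + 2 := ⟨n - 2, by omega⟩
  have hconn : ∀ t, br i (t - α) (j + 1) ≠ 0 → Q.eval t
      = A1 γ μ lam α i j (n + 2) t * MeixnerM γ μ (n + 2) t
        + B1 γ μ lam α i j (n + 2) t * MeixnerM γ μ (n + 1) t := fun t ht =>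
    sobolev_connection hγ hμ0 hμ1 hlam hQ ht
  set p : ℝ → ℝ := fun t => A1 γ μ lam α i j (n + 1) t * MeixnerM γ μ (n + 1) t
    + B1 γ μ lam α i j (n + 1) t * MeixnerM γ μ n t
  have hpt : ∀ t, p t = A2 γ μ lam α i j (n + 2) t * MeixnerM γ μ (n + 2) t
      + B2 γ μ lam α i j (n + 2) t * MeixnerM γ μ (n + 1) t := fun t =>
    connection_pred hγ hμ0 hμ1 _ _ n t
  have hDp : ∀ t, (t + γ * kdelta i 1) * Dop i p t
      = C2 γ μ lam α i j (n + 2) t * MeixnerM γ μ (n + 2) t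
        + D2 γ μ lam α i j (n + 2) t * MeixnerM γ μ (n + 1) t := fun t =>
    (Dop_connection hγ hμ0 hμ1 hi j n t).trans (connection_pred hγ hμ0 hμ1 _ _ n t)
  have hlad : ∀ t, br i (t - α) (j + 1) ≠ 0 → br i (sh i t - α) (j + 1) ≠ 0 →
      Thetatil γ μ lam α i j (n + 2) t * Dop i (fun t => Q.eval t) t
        + Lam γ μ lam α i j (n + 2) 2 1 t * Q.eval t
        = Lam γ μ lam α i j (n + 2) 1 1 t * p t := by
    intro t ht ht'
    have hd := Dop_connection (lam := lam) (α := α) hγ hμ0 hμ1 hi j (n + 1) t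
    rw [← Dop_congr (f := fun t => Q.eval t) (hconn t ht) (hconn _ ht')] at hd
    have h := ladder_of_connection (hconn t ht) (hpt t) hd
    simp only [Thetatil, Theta, Lam, Aa, Bb, Cc, Dd, if_true, OfNat.ofNat_ne_one, if_false]
    linear_combination h
  have hlad' : Thetatil γ μ lam α i j (n + 2) x * Dop i p x
      + Lam γ μ lam α i j (n + 2) 1 2 x * p x = Lam γ μ lam α i j (n + 2) 2 2 x * Q.eval x := by
    have h := ladder_of_connection (hconn x hbr) (hpt x) (hDp x)
    simp only [Thetatil, Theta, Lam, Aa, Bb, Cc, Dd, if_true, OfNat.ofNat_ne_one, if_false]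
    linear_combination h
  rw [hF, hG, hH]
  exact second_order_of_ladder (q := fun t => Q.eval t) (hlad x hbr hbr') (hlad _ hbr' hbr'')
    hlad' hL hL'
end
end

section
/- For i ∈ {1,2} and every real polynomial p, the polynomial ⟨x−α⟩_i^{j+1} p(x) satisfies 𝒟_i^j(⟨x−α⟩_i^{j+1} p(x)) = 0 at x = α; consequently, multiplication by ⟨x−α⟩_i^{j+1} is symmetric with respect to the Sobolev inner product: for all real polynomials p, q one has ⟨⟨x−α⟩_i^{j+1} p(x), q(x)⟩_λ = ⟨p(x), ⟨x−α⟩_i^{j+1} q(x)⟩_λ = ⟨⟨x−α⟩_i^{j+1} p(x), q(x)⟩. -/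
open Finset Filter Topology Polynomial

noncomputable section

theorem Dk_one_eq_zero (k : ℕ) (f : ℝ → ℝ) (x : ℝ) (h : ∀ m : ℕ, m ≤ k → f (x + m) = 0) :
    Dk 1 k f x = 0 := by
  induction k generalizing f with
  | zero => simpa [Dk] using h 0 le_rfl
  | succ k ih =>
    refine ih (Dop 1 f) fun m hm => ?_
    have h' := h (m + 1) (by omega)
    push_cast [← add_assoc] at h'
    simp [Dop, h', h m (by omega)]

theorem Dk_two_eq_zero (k : ℕ) (f : ℝ → ℝ) (x : ℝ) (h : ∀ m : ℕ, m ≤ k → f (x - m) = 0) :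
    Dk 2 k f x = 0 := by
  induction k generalizing f with
  | zero => simpa [Dk] using h 0 le_rfl
  | succ k ih =>
    refine ih (Dop 2 f) fun m hm => ?_
    have h' := h (m + 1) (by omega)
    push_cast [← sub_sub] at h'
    simp [Dop, h', h m (by omega)]

theorem Dk_br_mul_eq_zero (i j : ℕ) (hi : i = 1 ∨ i = 2) (f : ℝ → ℝ) (α : ℝ) :
    Dk i j (fun x => br i (x - α) (j + 1) * f x) α = 0 := by
  rcases hi with rfl | rfl
  · refine Dk_one_eq_zero j _ α fun m hm => mul_eq_zero_of_left ?_ _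
    simp only [br, fall, if_true]
    exact Finset.prod_eq_zero (Finset.mem_range.2 (Nat.lt_succ_of_le hm)) (by ring)
  · refine Dk_two_eq_zero j _ α fun m hm => mul_eq_zero_of_left ?_ _
    simp only [br, poch, OfNat.ofNat_ne_one, if_false]
    exact Finset.prod_eq_zero (Finset.mem_range.2 (Nat.lt_succ_of_le hm)) (by ring)

/-- multiplication by `⟨x−α⟩_i^{j+1}` is symmetric for the Sobolev inner product. -/
theorem multiplication_symmetric_sobolev (γ μ lam α : ℝ) (hγ : 0 < γ) (hμ0 : 0 < μ)
    (hμ1 : μ < 1) (hlam : 0 < lam) (hα : α ≤ 0) (j i : ℕ) (hi : i = 1 ∨ i = 2)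
    (p q : Polynomial ℝ) :
    Dk i j (fun x => br i (x - α) (j + 1) * p.eval x) α = 0 ∧
    sIP γ μ lam α i j (fun x => br i (x - α) (j + 1) * p.eval x) (fun x => q.eval x) =
      sIP γ μ lam α i j (fun x => p.eval x) (fun x => br i (x - α) (j + 1) * q.eval x) ∧
    sIP γ μ lam α i j (fun x => br i (x - α) (j + 1) * p.eval x) (fun x => q.eval x) =
      mIP γ μ (fun x => br i (x - α) (j + 1) * p.eval x) (fun x => q.eval x) := by
  have hD := Dk_br_mul_eq_zero i j hi
  refine ⟨hD _ α, ?_, ?_⟩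
  · simp only [sIP, mIP, hD, mul_zero, zero_mul, add_zero]
    exact tsum_congr fun x => by ring
  · simp only [sIP, hD, mul_zero, zero_mul, add_zero]
end
end
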